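/- arXiv:1910.10770 — 2 statements merged into one kernel-verified Lean document; each statement's English description precedes it below -/
import Mathlib

section
/- For all real numbers a and b, the R-conjunction value a + b − √(a² + b²) is strictly positive if and only if both a > 0 and b > 0. -/
/-- The R-conjunction `a + b − √(a² + b²)` is strictly positive iff both `a > 0` and `b > 0`. -/
theorem r_conjunction_pos_iff (a b : ℝ) :
    0 < a + b - Real.sqrt (a ^ 2 + b ^ 2) ↔ 0 < a ∧ 0 < b := by
  rw [sub_pos]
  constructor
  · intro h
    have ha : a ≤ Real.sqrt (a ^ 2 + b ^ 2) :=
      Real.le_sqrt_of_sq_le (le_add_of_nonneg_right (sq_nonneg b))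
    have hb : b ≤ Real.sqrt (a ^ 2 + b ^ 2) :=
      Real.le_sqrt_of_sq_le (le_add_of_nonneg_left (sq_nonneg a))
    constructor <;> linarith
  · rintro ⟨ha, hb⟩
    rw [Real.sqrt_lt' (add_pos ha hb)]
    nlinarith [mul_pos ha hb]
end

section
/- For all real numbers a and b, the R-disjunction value a + b + √(a² + b²) is strictly positive if and only if a > 0 or b > 0. -/
/-- The R-disjunction `a + b + √(a² + b²)` is strictly positive iff `a > 0` or `b > 0`. -/
theorem r_disjunction_pos_iff (a b : ℝ) :
    0 < a + b + Real.sqrt (a ^ 2 + b ^ 2) ↔ 0 < a ∨ 0 < b := by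
  constructor
  · intro h
    by_contra! hab
    obtain ⟨ha, hb⟩ := hab
    have hle : Real.sqrt (a ^ 2 + b ^ 2) ≤ -(a + b) :=
      Real.sqrt_le_iff.mpr ⟨by linarith, by nlinarith [mul_nonneg_of_nonpos_of_nonpos ha hb]⟩
    linarith
  · have hsqrt_a : -a ≤ Real.sqrt (a ^ 2 + b ^ 2) :=
      Real.le_sqrt_of_sq_le (by nlinarith [sq_nonneg b])
    have hsqrt_b : -b ≤ Real.sqrt (a ^ 2 + b ^ 2) :=
      Real.le_sqrt_of_sq_le (by nlinarith [sq_nonneg a])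
    rintro (ha | hb) <;> linarith
end
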